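/- Let k be an algebraically closed field of characteristic different from 2. The action of PGL_2(k) on the 3-dimensional space of binary quadratic forms by [A]·q(x) = det(A)·q(A^{-1}x) preserves the discriminant quadratic form on this space and induces an isomorphism of groups PGL_2(k) ≅ SO_3(k). -/

import Mathlib

open Matrix MvPolynomial

variable (k : Type*) [Field k]

/-- The orthogonal group of the quadratic form with Gram matrix `M`, as the subgroup of
`GL₃(k)` of matrices `A` with `Aᵀ M A = M`. -/
def orthGrp (M : Matrix (Fin 3) (Fin 3) k) : Subgroup (GL (Fin 3) k) where
  carrier := {A | (A : Matrix (Fin 3) (Fin 3) k)ᵀ * M * (A : Matrix (Fin 3) (Fin 3) k) = M}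
  one_mem' := by simp
  mul_mem' := by
    rintro A B hA hB
    have : ((A * B : GL (Fin 3) k) : Matrix (Fin 3) (Fin 3) k) =
        (A : Matrix (Fin 3) (Fin 3) k) * (B : Matrix (Fin 3) (Fin 3) k) := rfl
    simp only [Set.mem_setOf_eq, this, Matrix.transpose_mul] at *
    calc (B : Matrix (Fin 3) (Fin 3) k)ᵀ * (A : Matrix (Fin 3) (Fin 3) k)ᵀ * M *
          ((A : Matrix (Fin 3) (Fin 3) k) * (B : Matrix (Fin 3) (Fin 3) k))
        = (B : Matrix (Fin 3) (Fin 3) k)ᵀ *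
            ((A : Matrix (Fin 3) (Fin 3) k)ᵀ * M * (A : Matrix (Fin 3) (Fin 3) k)) *
            (B : Matrix (Fin 3) (Fin 3) k) := by noncomm_ring
      _ = M := by rw [hA]; exact hB
  inv_mem' := by
    rintro A hA
    simp only [Set.mem_setOf_eq] at *
    have h1 : M = ((A⁻¹ : GL (Fin 3) k) : Matrix (Fin 3) (Fin 3) k)ᵀ *
        ((A : Matrix (Fin 3) (Fin 3) k)ᵀ * M * (A : Matrix (Fin 3) (Fin 3) k)) *
        ((A⁻¹ : GL (Fin 3) k) : Matrix (Fin 3) (Fin 3) k) := by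
      have hAA : (A : Matrix (Fin 3) (Fin 3) k) *
          ((A⁻¹ : GL (Fin 3) k) : Matrix (Fin 3) (Fin 3) k) = 1 := by
        rw [← Units.val_mul, mul_inv_cancel, Units.val_one]
      calc M = 1ᵀ * M * 1 := by simp
        _ = ((A : Matrix (Fin 3) (Fin 3) k) *
              ((A⁻¹ : GL (Fin 3) k) : Matrix (Fin 3) (Fin 3) k))ᵀ * M *
            ((A : Matrix (Fin 3) (Fin 3) k) *
              ((A⁻¹ : GL (Fin 3) k) : Matrix (Fin 3) (Fin 3) k)) := by rw [hAA]
        _ = _ := by rw [Matrix.transpose_mul]; noncomm_ring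
    rw [hA] at h1
    exact h1.symm

/-- `SO₃`: the special orthogonal group of the form with Gram matrix `M`. -/
def soGrp (M : Matrix (Fin 3) (Fin 3) k) : Subgroup (GL (Fin 3) k) :=
  orthGrp k M ⊓ MonoidHom.ker (Matrix.GeneralLinearGroup.det)

/-- The Gram matrix of the discriminant quadratic form `b² − 4ac` on the space of binary
quadratic forms `ax² + bxy + cy²` with coordinates `(a, b, c)`. -/
def discGram : Matrix (Fin 3) (Fin 3) k := !![0, 0, -2; 0, 1, 0; -2, 0, 0]

/-- The action of `A ∈ GL₂` on binary quadratic forms: `A·q(x) = det(A)·q(A⁻¹x)`. -/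
noncomputable def qAct (A : GL (Fin 2) k) (q : MvPolynomial (Fin 2) k) :
    MvPolynomial (Fin 2) k :=
  ((A : Matrix (Fin 2) (Fin 2) k)).det •
    aeval (fun i : Fin 2 => ∑ j : Fin 2,
      ((A⁻¹ : GL (Fin 2) k) : Matrix (Fin 2) (Fin 2) k) i j • (X j : MvPolynomial (Fin 2) k)) q

/-- The discriminant `b² − 4ac` of a binary quadratic form `ax² + bxy + cy²`. -/
noncomputable def discQ (q : MvPolynomial (Fin 2) k) : k :=
  (coeff (Finsupp.single 0 1 + Finsupp.single 1 1) q) ^ 2 -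
    4 * coeff (Finsupp.single 0 2) q * coeff (Finsupp.single 1 2) q

/-- The coefficient vector `(a, b, c)` of a binary quadratic form. -/
noncomputable def coeffVec (q : MvPolynomial (Fin 2) k) : Fin 3 → k :=
  ![coeff (Finsupp.single 0 2) q,
    coeff (Finsupp.single 0 1 + Finsupp.single 1 1) q,
    coeff (Finsupp.single 1 2) q]


section Helpers

variable {k}

/-- The form with given coefficients. -/
noncomputable def formOf (a b c : k) : MvPolynomial (Fin 2) k :=
  C a * X 0 ^ 2 + C b * (X 0 * X 1) + C c * X 1 ^ 2

lemma formOf_eq (a b c : k) : formOf a b c =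
    monomial (Finsupp.single 0 2) a + monomial (Finsupp.single 0 1 + Finsupp.single 1 1) b
      + monomial (Finsupp.single 1 2) c := by
  unfold formOf
  rw [X_pow_eq_monomial, X_pow_eq_monomial]
  simp only [X, monomial_mul, C_mul_monomial, mul_one]

lemma ne1 : (Finsupp.single 0 2 : Fin 2 →₀ ℕ) ≠ Finsupp.single 0 1 + Finsupp.single 1 1 := by
  intro h
  have := DFunLike.congr_fun h 0
  simp at this

lemma ne2 : (Finsupp.single 0 2 : Fin 2 →₀ ℕ) ≠ Finsupp.single 1 2 := by
  intro h
  have := DFunLike.congr_fun h 0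
  simp at this

lemma ne3 : (Finsupp.single 1 2 : Fin 2 →₀ ℕ) ≠ Finsupp.single 0 1 + Finsupp.single 1 1 := by
  intro h
  have := DFunLike.congr_fun h 0
  simp at this

lemma coeffVec_formOf (a b c : k) : coeffVec k (formOf a b c) = ![a, b, c] := by
  unfold coeffVec
  simp only [formOf_eq, coeff_add, coeff_monomial, ne1, ne2, ne3, ne1.symm, ne2.symm, ne3.symm,
    if_true, if_false, add_zero, zero_add]

lemma eq_formOf (q : MvPolynomial (Fin 2) k) (hq : q.IsHomogeneous 2) :
    ∃ a b c, q = formOf a b c := by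
  refine ⟨coeff (Finsupp.single 0 2) q, coeff (Finsupp.single 0 1 + Finsupp.single 1 1) q,
    coeff (Finsupp.single 1 2) q, ?_⟩
  rw [formOf_eq]
  ext d
  simp only [coeff_add, coeff_monomial]
  by_cases hd : d.degree = 2
  · have hd' : d 0 + d 1 = 2 := by
      rw [Finsupp.degree_eq_sum] at hd
      simpa using hd
    have h3 : d = Finsupp.single 0 2 ∨ d = Finsupp.single 0 1 + Finsupp.single 1 1 ∨
        d = Finsupp.single 1 2 := by
      have : d 0 = 2 ∧ d 1 = 0 ∨ d 0 = 1 ∧ d 1 = 1 ∨ d 0 = 0 ∧ d 1 = 2 := by omega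
      rcases this with h | h | h
      · left; ext i; fin_cases i <;> simp [h]
      · right; left; ext i; fin_cases i <;> simp [h]
      · right; right; ext i; fin_cases i <;> simp [h]
    rcases h3 with rfl | rfl | rfl <;>
    simp only [ne1, ne2, ne3, ne1.symm, ne2.symm, ne3.symm,
      if_true, if_false, add_zero, zero_add]
  · rw [hq.coeff_eq_zero hd]
    rw [if_neg, if_neg, if_neg]
    · simp
    all_goals
      rintro rfl
      apply hd
      simp

/-- The matrix of the action, up to the inverse determinant. -/
def symMat (A : Matrix (Fin 2) (Fin 2) k) : Matrix (Fin 3) (Fin 3) k :=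
  !![A 1 1 ^ 2, -(A 1 1 * A 1 0), A 1 0 ^ 2;
    -(2 * A 1 1 * A 0 1), A 1 1 * A 0 0 + A 0 1 * A 1 0, -(2 * A 1 0 * A 0 0);
    A 0 1 ^ 2, -(A 0 1 * A 0 0), A 0 0 ^ 2]

lemma symMat_mul (A B : Matrix (Fin 2) (Fin 2) k) : symMat (A * B) = symMat A * symMat B := by
  ext i j
  fin_cases i <;> fin_cases j <;>
    simp [symMat, Matrix.mul_apply, Fin.sum_univ_succ] <;> ring

lemma symMat_det (A : Matrix (Fin 2) (Fin 2) k) : (symMat A).det = A.det ^ 3 := by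
  simp [symMat, Matrix.det_fin_three, Matrix.det_fin_two]; ring

lemma symMat_orth (A : Matrix (Fin 2) (Fin 2) k) :
    (symMat A)ᵀ * discGram k * symMat A = A.det ^ 2 • discGram k := by
  ext i j
  fin_cases i <;> fin_cases j <;>
    simp [symMat, discGram, Matrix.mul_apply, Fin.sum_univ_succ, Matrix.det_fin_two] <;> ring

/-- The matrix of the action. -/
noncomputable def actMat (A : Matrix (Fin 2) (Fin 2) k) : Matrix (Fin 3) (Fin 3) k :=
  A.det⁻¹ • symMat A

lemma actMat_mul (A B : Matrix (Fin 2) (Fin 2) k) : actMat (A * B) = actMat A * actMat B := by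
  simp only [actMat, symMat_mul, Matrix.det_mul, mul_inv, Matrix.smul_mul, Matrix.mul_smul,
    smul_smul]
  rw [mul_comm]

lemma actMat_one : actMat (1 : Matrix (Fin 2) (Fin 2) k) = 1 := by
  ext i j
  fin_cases i <;> fin_cases j <;> simp [actMat, symMat]

/-- The homomorphism to the general linear group. -/
noncomputable def actHom : GL (Fin 2) k →* GL (Fin 3) k :=
  Units.map ({ toFun := actMat, map_one' := actMat_one, map_mul' := actMat_mul } :
    Matrix (Fin 2) (Fin 2) k →* Matrix (Fin 3) (Fin 3) k)

lemma actHom_coe (A : GL (Fin 2) k) :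
    ((actHom A : GL (Fin 3) k) : Matrix (Fin 3) (Fin 3) k) = actMat (A : Matrix _ _ k) := rfl

lemma det_ne (A : GL (Fin 2) k) : (A : Matrix (Fin 2) (Fin 2) k).det ≠ 0 :=
  ((Matrix.isUnit_iff_isUnit_det _).1 A.isUnit).ne_zero

lemma qAct_formOf (A : GL (Fin 2) k) (a b c : k) :
    coeffVec k (qAct k A (formOf a b c)) = actMat (A : Matrix _ _ k) *ᵥ ![a, b, c] := by
  have hD := det_ne A
  have hinv : ((A⁻¹ : GL (Fin 2) k) : Matrix (Fin 2) (Fin 2) k) =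
      (A : Matrix (Fin 2) (Fin 2) k).det⁻¹ • !![A 1 1, -A 0 1; -A 1 0, A 0 0] := by
    rw [Matrix.coe_units_inv, Matrix.inv_def, Matrix.adjugate_fin_two, Ring.inverse_eq_inv']
  obtain ⟨D, hDe⟩ : ∃ D, D = (A : Matrix (Fin 2) (Fin 2) k).det := ⟨_, rfl⟩
  have key : qAct k A (formOf a b c) = formOf
      (D⁻¹ * (A 1 1 ^ 2 * a - A 1 1 * A 1 0 * b + A 1 0 ^ 2 * c))
      (D⁻¹ * (-2 * A 1 1 * A 0 1 * a + (A 1 1 * A 0 0 + A 0 1 * A 1 0) * b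
        - 2 * A 1 0 * A 0 0 * c))
      (D⁻¹ * (A 0 1 ^ 2 * a - A 0 1 * A 0 0 * b + A 0 0 ^ 2 * c)) := by
    unfold qAct formOf
    rw [hinv, ← hDe]
    rw [← hDe] at hD
    have hC : (C D * C D⁻¹ : MvPolynomial (Fin 2) k) = 1 := by
      rw [← C_mul, mul_inv_cancel₀ hD, C_1]
    have h2 : (C 2 : MvPolynomial (Fin 2) k) = 2 := map_ofNat C 2
    simp only [map_add, map_mul, map_pow, aeval_X, Fin.sum_univ_two, algHom_C, algebraMap_eq,
      smul_eq_C_mul, Matrix.smul_apply, smul_eq_mul, Matrix.of_apply, Matrix.cons_val', 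
      Matrix.cons_val_zero, Matrix.cons_val_one, Matrix.cons_val_fin_one, C_mul, C_neg, C_add,
      C_sub, C_pow, h2, map_neg, map_sub]
    linear_combination (C D⁻¹ * (
      C a * (C (A 1 1) * X 0 - C (A 0 1) * X 1) ^ 2
      + C b * (C (A 1 1) * X 0 - C (A 0 1) * X 1) * (C (A 0 0) * X 1 - C (A 1 0) * X 0)
      + C c * (C (A 0 0) * X 1 - C (A 1 0) * X 0) ^ 2)) * hC
  rw [key, coeffVec_formOf, actMat, ← hDe]
  ext i
  fin_cases i <;> simp [symMat, Matrix.mulVec, dotProduct, Fin.sum_univ_succ] <;> ring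

lemma discQ_eq (q : MvPolynomial (Fin 2) k) :
    discQ k q = coeffVec k q ⬝ᵥ (discGram k *ᵥ coeffVec k q) := by
  simp [discQ, coeffVec, discGram, Matrix.mulVec, dotProduct, Fin.sum_univ_succ]
  ring

lemma actMat_orth (A : GL (Fin 2) k) :
    (actMat (A : Matrix _ _ k))ᵀ * discGram k * actMat (A : Matrix _ _ k) = discGram k := by
  have hD := det_ne A
  simp only [actMat, Matrix.transpose_smul, Matrix.smul_mul, Matrix.mul_smul, symMat_orth,
    smul_smul]
  rw [show ∀ d : k, d⁻¹ * (d⁻¹ * d ^ 2) = (d⁻¹ * d) ^ 2 by intro d; ring,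
    inv_mul_cancel₀ hD, one_pow, one_smul]

lemma actMat_det (A : GL (Fin 2) k) : (actMat (A : Matrix _ _ k)).det = 1 := by
  have hD := det_ne A
  rw [actMat, Matrix.det_smul, symMat_det, Fintype.card_fin, ← mul_pow, inv_mul_cancel₀ hD,
    one_pow]

lemma actHom_mem (A : GL (Fin 2) k) : actHom A ∈ soGrp k (discGram k) := by
  refine ⟨actMat_orth A, ?_⟩
  refine MonoidHom.mem_ker.2 ?_
  ext
  simpa [actHom_coe] using actMat_det A

lemma scalar_iff (A : GL (Fin 2) k) : A ∈ Subgroup.center (GL (Fin 2) k) ↔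
    (A 0 1 = 0 ∧ A 1 0 = 0 ∧ A 0 0 = A 1 1) := by
  rw [Matrix.GeneralLinearGroup.mem_center_iff_val_mem_range_scalar]
  constructor
  · rintro ⟨t, h⟩
    rw [← h]
    simp
  · rintro ⟨h1, h2, h3⟩
    refine ⟨A 1 1, ?_⟩
    ext i j
    fin_cases i <;> fin_cases j <;> simp [h1, h2, h3]

lemma ker_actHom : MonoidHom.ker (actHom (k := k)) = Subgroup.center (GL (Fin 2) k) := by
  ext A
  have hD := det_ne A
  rw [scalar_iff, MonoidHom.mem_ker, ← Units.val_inj, actHom_coe, Units.val_one]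
  constructor
  · intro h
    have e (i j) := congrFun (congrFun h i) j
    have h1 := e 0 2
    have h2 := e 2 0
    have h3 := e 1 1
    have h4 := e 0 0
    simp [actMat, symMat, hD] at h1 h2 h3 h4
    refine ⟨h2, h1, ?_⟩
    rw [Matrix.det_fin_two] at *
    simp only [h1, h2, mul_zero, add_zero, sub_zero] at *
    have h5 : (A : Matrix (Fin 2) (Fin 2) k) 1 1 ≠ 0 := right_ne_zero_of_mul hD
    have h6 : (A : Matrix (Fin 2) (Fin 2) k) 0 0 ≠ 0 := left_ne_zero_of_mul hD
    field_simp at h4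
    exact h4.symm
  · rintro ⟨h1, h2, h3⟩
    rw [Matrix.det_fin_two] at hD
    simp only [h1, h2, h3, mul_zero, sub_zero] at hD
    have h5 := right_ne_zero_of_mul hD
    ext i j
    fin_cases i <;> fin_cases j <;>
      simp [actMat, symMat, h1, h2, h3, Matrix.det_fin_two] <;> field_simp

lemma exists_col [IsAlgClosed k] (hchar : (2 : k) ≠ 0) (x y z : k) (h : y ^ 2 = 4 * x * z)
    (hne : ¬ (x = 0 ∧ y = 0 ∧ z = 0)) :
    ∃ A : GL (Fin 2) k, actMat (A : Matrix _ _ k) *ᵥ ![1, 0, 0] = ![x, y, z] := by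
  obtain ⟨s, hs⟩ := IsAlgClosed.exists_pow_nat_eq x (n := 2) (by norm_num)
  obtain ⟨q, hq, hy⟩ : ∃ q, q ^ 2 = z ∧ y = -(2 * s * q) := by
    obtain ⟨q, hq⟩ := IsAlgClosed.exists_pow_nat_eq z (n := 2) (by norm_num)
    have : (y - 2 * s * q) * (y + 2 * s * q) = 0 := by
      rw [← hs, ← hq] at h
      linear_combination h
    rcases mul_eq_zero.1 this with h | h
    · exact ⟨-q, by simpa using hq, by linear_combination h⟩
    · exact ⟨q, hq, by linear_combination h⟩
  obtain ⟨p, r, hpr⟩ : ∃ p r, p * s - q * r = 1 := by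
    by_cases h0 : s = 0
    · have : q ≠ 0 := by
        rintro rfl
        apply hne
        subst h0
        simp at hs hq hy
        exact ⟨hs.symm, hy, hq.symm⟩
      exact ⟨0, -q⁻¹, by simp [this]⟩
    · exact ⟨s⁻¹, 0, by simp [h0]⟩
  have hdet : (!![p, q; r, s] : Matrix (Fin 2) (Fin 2) k).det = 1 := by
    rw [Matrix.det_fin_two_of, hpr]
  refine ⟨Matrix.GeneralLinearGroup.mkOfDetNeZero !![p, q; r, s] (by rw [hdet]; exact one_ne_zero),
    ?_⟩
  change actMat !![p, q; r, s] *ᵥ _ = _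
  rw [actMat, hdet]
  ext i
  fin_cases i <;> simp [symMat, Matrix.mulVec, dotProduct, Fin.sum_univ_succ, hs, hq, hy]

lemma exists_unip (hchar : (2 : k) ≠ 0) (M : GL (Fin 3) k) (hM : M ∈ soGrp k (discGram k))
    (h : (M : Matrix (Fin 3) (Fin 3) k) *ᵥ ![1, 0, 0] = ![1, 0, 0]) :
    ∃ A : GL (Fin 2) k, actHom A = M := by
  obtain ⟨ho, hd⟩ := hM
  have ho : (M : Matrix (Fin 3) (Fin 3) k)ᵀ * discGram k * (M : Matrix (Fin 3) (Fin 3) k)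
    = discGram k := ho
  have hd : (M : Matrix (Fin 3) (Fin 3) k).det = 1 := by
    have := congrArg Units.val (MonoidHom.mem_ker.1 hd)
    simpa using this
  generalize hN : (M : Matrix (Fin 3) (Fin 3) k) = N at *
  have c (i) := congrFun h i
  have c0 := c 0
  have c1 := c 1
  have c2 := c 2
  simp [Matrix.mulVec, dotProduct, Fin.sum_univ_succ] at c0 c1 c2
  have e (i j) := congrFun (congrFun ho i) j
  have e01 := e 0 1
  have e02 := e 0 2
  have e12 := e 1 2
  have e22 := e 2 2
  simp [discGram, Matrix.mul_apply, Fin.sum_univ_succ, c0, c1, c2, hchar] at e01 e02 e12 e22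
  rw [Matrix.det_fin_three] at hd
  simp [c0, c1, c2, e01, e02] at hd e12 e22
  simp [hd] at e12 e22
  have f12 : N 1 2 = 2 * N 0 1 := by linear_combination e12
  have f02 : N 0 2 = N 0 1 ^ 2 := by
    apply mul_left_cancel₀ (mul_ne_zero hchar hchar)
    rw [f12] at e22
    linear_combination -e22
  have hdet : (!![1, 0; -N 0 1, 1] : Matrix (Fin 2) (Fin 2) k).det = 1 := by
    simp [Matrix.det_fin_two_of]
  refine ⟨Matrix.GeneralLinearGroup.mkOfDetNeZero !![1, 0; -N 0 1, 1]
    (by rw [hdet]; exact one_ne_zero), ?_⟩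
  rw [← Units.val_inj, hN]
  change actMat !![1, 0; -N 0 1, 1] = _
  rw [actMat, hdet]
  ext i j
  fin_cases i <;> fin_cases j <;> simp [symMat, c0, c1, c2, e01, e02, hd, f12, f02]

lemma range_actHom [IsAlgClosed k] (hchar : (2 : k) ≠ 0) :
    MonoidHom.range (actHom (k := k)) = soGrp k (discGram k) := by
  apply le_antisymm
  · rintro _ ⟨A, rfl⟩
    exact actHom_mem A
  · intro M hM
    have ho : (M : Matrix (Fin 3) (Fin 3) k)ᵀ * discGram k * (M : Matrix (Fin 3) (Fin 3) k)
      = discGram k := hM.1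
    have e00 := congrFun (congrFun ho 0) 0
    have e02 := congrFun (congrFun ho 0) 2
    simp [discGram, Matrix.mul_apply, Fin.sum_univ_succ] at e00 e02
    obtain ⟨A, hA⟩ := exists_col hchar (M 0 0) (M 1 0) (M 2 0)
      (by linear_combination e00) (by
        rintro ⟨h0, h1, h2⟩
        simp [h0, h1, h2] at e02
        exact hchar e02)
    have hcol : (M : Matrix (Fin 3) (Fin 3) k) *ᵥ ![1, 0, 0] = ![M 0 0, M 1 0, M 2 0] := by
      ext i
      fin_cases i <;> simp [Matrix.mulVec, dotProduct, Fin.sum_univ_succ]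
    obtain ⟨B, hB⟩ := exists_unip hchar ((actHom A)⁻¹ * M)
      (mul_mem (inv_mem (actHom_mem A)) hM) (by
        rw [Units.val_mul, ← Matrix.mulVec_mulVec, hcol, ← hA, ← actHom_coe,
          Matrix.mulVec_mulVec, ← Units.val_mul, inv_mul_cancel, Units.val_one,
          Matrix.one_mulVec])
    exact ⟨A * B, by rw [map_mul, hB, mul_inv_cancel_left]⟩

end Helpers

/-- Over an algebraically closed field of characteristic `≠ 2`, the action
`[A]·q(x) = det(A)·q(A⁻¹x)` of `PGL₂(k)` on binary quadratic forms preserves the discriminant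
`b² − 4ac`, and the induced homomorphism `GL₂(k) → GL₃(k)` on the coefficient space has
kernel exactly the center (the scalars) and image `SO₃(k)`; thus it induces an isomorphism
`PGL₂(k) ≅ SO₃(k)`. -/
theorem stmt10 [IsAlgClosed k] (hchar : (2 : k) ≠ 0) :
    (∀ (A : GL (Fin 2) k) (q : MvPolynomial (Fin 2) k), q.IsHomogeneous 2 →
      discQ k (qAct k A q) = discQ k q) ∧
    (∃ φ : GL (Fin 2) k →* GL (Fin 3) k,
      (∀ (A : GL (Fin 2) k) (q : MvPolynomial (Fin 2) k), q.IsHomogeneous 2 →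
        coeffVec k (qAct k A q) = ((φ A : GL (Fin 3) k) : Matrix (Fin 3) (Fin 3) k) *ᵥ
          coeffVec k q) ∧
      MonoidHom.ker φ = Subgroup.center (GL (Fin 2) k) ∧
      MonoidHom.range φ = soGrp k (discGram k)) := by
  have hact : ∀ (A : GL (Fin 2) k) (q : MvPolynomial (Fin 2) k), q.IsHomogeneous 2 →
      coeffVec k (qAct k A q) = actMat (A : Matrix _ _ k) *ᵥ coeffVec k q := by
    intro A q hq
    obtain ⟨a, b, c, rfl⟩ := eq_formOf q hq
    rw [qAct_formOf, coeffVec_formOf]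
  refine ⟨?_, actHom, hact, ker_actHom, range_actHom hchar⟩
  intro A q hq
  rw [discQ_eq, discQ_eq, hact A q hq]
  conv_rhs => rw [← actMat_orth A]
  rw [← Matrix.mulVec_mulVec, ← Matrix.mulVec_mulVec, Matrix.mulVec_transpose,
    dotProduct_comm (coeffVec k q), ← Matrix.dotProduct_mulVec, dotProduct_comm]
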